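/- arXiv:1712.00716 — 2 statements merged into one kernel-verified Lean document; each statement's English description precedes it below -/
import Mathlib

section
/- Fix σ² > 1/2 and x ∈ ℂ^n with ‖x‖ = 1, let g ∼ CN(0, I_m), and let M(g) := ((2σ²+1)/m)·A^* diag(ζ_{σ²}(|A x|)) A and H(g) := P_{x⊥} M(g) P_{x⊥}, where P_{x⊥} := I − x x^*. Then E[M(g)] = P_{x⊥} + ((1+4σ²)/(1+2σ²))·x x^* (equivalently E[M(g)] = I + (2σ²/(1+2σ²))·x x^*) and E[H(g)] = P_{x⊥}, where the expectations are entrywise Bochner integrals over the law of g. -/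
open MeasureTheory ProbabilityTheory Matrix Complex
open scoped NNReal ENNReal

noncomputable section

namespace ConvPR

/-- The complex Gaussian distribution `CN(0, σ²)` on `ℂ`, as the pushforward of the
product of two real Gaussians `N(0, σ²/2)` under `(u, v) ↦ u + i v`. -/
def cgaussian (σ2 : ℝ) : Measure ℂ :=
  Measure.map (fun p : ℝ × ℝ => (p.1 : ℂ) + (p.2 : ℂ) * Complex.I)
    ((gaussianReal 0 (σ2 / 2).toNNReal).prod (gaussianReal 0 (σ2 / 2).toNNReal))

/-- The complex Gaussian `CN(0, σ² I_m)` on `Fin m → ℂ`. -/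
def cgaussianVec (m : ℕ) (σ2 : ℝ) : Measure (Fin m → ℂ) :=
  Measure.pi fun _ => cgaussian σ2

/-- The Euclidean norm on `Fin k → ℂ`. -/
def cnorm {k : ℕ} (v : Fin k → ℂ) : ℝ := Real.sqrt (∑ i, ‖v i‖ ^ 2)

/-- The Euclidean norm on `Fin k → ℝ`. -/
def rnorm {k : ℕ} (v : Fin k → ℝ) : ℝ := Real.sqrt (∑ i, v i ^ 2)

/-- The operator (spectral) norm of a complex matrix. -/
def opNorm {k l : ℕ} (M : Matrix (Fin k) (Fin l) ℂ) : ℝ :=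
  sSup {r : ℝ | ∃ v : Fin l → ℂ, cnorm v ≤ 1 ∧ r = cnorm (M.mulVec v)}

/-- Zero-padding `ℂ^n → ℂ^m`. -/
def pad {n : ℕ} (m : ℕ) (x : Fin n → ℂ) : Fin m → ℂ :=
  fun i => if hi : (i : ℕ) < n then x ⟨(i : ℕ), hi⟩ else 0

/-- The `m × n` matrix `A` formed by the first `n` columns of the circulant matrix `C_a`,
so that `A x = a ⊛ x`. -/
def Amat {n m : ℕ} (h : n ≤ m) (a : Fin m → ℂ) : Matrix (Fin m) (Fin n) ℂ :=
  Matrix.of fun i j => Matrix.circulant a i (Fin.castLE h j)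

/-- The circulant matrix `C_x` generated by the zero-padding of `x`. -/
def Cx {n : ℕ} (m : ℕ) (x : Fin n → ℂ) : Matrix (Fin m) (Fin m) ℂ :=
  Matrix.circulant (pad m x)

/-- `exp (i φ(u)) = u / |u|` for `u ≠ 0`, and `1` for `u = 0`. -/
def phase (u : ℂ) : ℂ := if u = 0 then 1 else u / (‖u‖ : ℂ)

/-- `ζ_{σ²}(t) = 1 − exp (−|t|² / (2σ²))`. -/
def zeta (σ2 : ℝ) (t : ℂ) : ℝ := 1 - Real.exp (-‖t‖ ^ 2 / (2 * σ2))

/-- `dist (z, X)` where `X = { x e^{iθ} : θ ∈ [0, 2π) }`. -/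
def distX {n : ℕ} (x z : Fin n → ℂ) : ℝ :=
  sInf {r : ℝ | ∃ θ ∈ Set.Ico (0 : ℝ) (2 * Real.pi),
    r = cnorm (z - Complex.exp ((θ : ℂ) * Complex.I) • x)}

/-- `y = |A x|`. -/
def yvec {n m : ℕ} (h : n ≤ m) (x : Fin n → ℂ) (a : Fin m → ℂ) : Fin m → ℝ :=
  fun k => ‖(Amat h a).mulVec x k‖

/-- The Hermitian inner product `x^* z`. -/
def dotc {n : ℕ} (x z : Fin n → ℂ) : ℂ := ∑ i, starRingEnd ℂ (x i) * z i

/-- `ψ(t) = exp (−2 i φ(t))`. -/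
def psi (t : ℂ) : ℂ := starRingEnd ℂ (phase t) ^ 2

/-- The Gaussian smoothing `h(t) = E_{s ∼ CN(0,1)} [ψ(t+s)]`. -/
def hfun (t : ℂ) : ℂ := ∫ s, psi (t + s) ∂(cgaussian 1)

/-- `Δ_∞(ε) = (1 + 2σ²) · sup_t |(1+ε) h(t) − ζ_{σ²}(t) ψ(t)|`. -/
def DeltaInf (σ2 ε : ℝ) : ℝ :=
  (1 + 2 * σ2) *
    sSup {r : ℝ | ∃ t : ℂ, r = ‖((1 + ε : ℝ) : ℂ) * hfun t - ((zeta σ2 t : ℝ) : ℂ) * psi t‖}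

/-- The generalized (Wirtinger) gradient of the weighted amplitude objective. -/
def grad {n m : ℕ} (h : n ≤ m) (σ2 : ℝ) (x : Fin n → ℂ) (a : Fin m → ℂ)
    (z : Fin n → ℂ) : Fin n → ℂ :=
  ((1 / (m : ℝ) : ℝ) : ℂ) •
    (Amat h a)ᴴ.mulVec fun k =>
      ((zeta σ2 ((yvec h x a k : ℝ) : ℂ) : ℝ) : ℂ) *
        ((Amat h a).mulVec z k - ((yvec h x a k : ℝ) : ℂ) * phase ((Amat h a).mulVec z k))

/-- The spectral-method matrix `Y = (1/m) A^* diag(y²) A`. -/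
def Ymat {n m : ℕ} (h : n ≤ m) (x : Fin n → ℂ) (a : Fin m → ℂ) :
    Matrix (Fin n) (Fin n) ℂ :=
  ((1 / (m : ℝ) : ℝ) : ℂ) •
    ((Amat h a)ᴴ * Matrix.diagonal (fun k => ((yvec h x a k ^ 2 : ℝ) : ℂ)) * Amat h a)

/-- The norm estimate `λ = sqrt((1/m) ∑ y_k²)`. -/
def lam {n m : ℕ} (h : n ≤ m) (x : Fin n → ℂ) (a : Fin m → ℂ) : ℝ :=
  Real.sqrt ((1 / (m : ℝ)) * ∑ k, yvec h x a k ^ 2)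

/-- `v` is a unit-norm eigenvector of `Y` associated with its largest eigenvalue. -/
def IsTopEigenvector {n : ℕ} (Y : Matrix (Fin n) (Fin n) ℂ) (v : Fin n → ℂ) : Prop :=
  cnorm v = 1 ∧ ∃ μ : ℝ, Y.mulVec v = (μ : ℂ) • v ∧
    ∀ μ' : ℝ, (∃ w : Fin n → ℂ, w ≠ 0 ∧ Y.mulVec w = (μ' : ℂ) • w) → μ' ≤ μ

/-- `M = ((2σ²+1)/m) A^* diag(ζ_{σ²}(y)) A`. -/
def Mmat {n m : ℕ} (h : n ≤ m) (σ2 : ℝ) (x : Fin n → ℂ) (a : Fin m → ℂ) :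
    Matrix (Fin n) (Fin n) ℂ :=
  (((2 * σ2 + 1) / (m : ℝ) : ℝ) : ℂ) •
    ((Amat h a)ᴴ *
      Matrix.diagonal (fun k => ((zeta σ2 ((yvec h x a k : ℝ) : ℂ) : ℝ) : ℂ)) * Amat h a)

/-- The vector `d(z)` from the contraction analysis. -/
def dvec {n m : ℕ} (h : n ≤ m) (σ2 : ℝ) (x : Fin n → ℂ) (a : Fin m → ℂ)
    (z : Fin n → ℂ) (θ : ℝ) : Fin n → ℂ :=
  (1 - Mmat h σ2 x a).mulVec (z - Complex.exp ((θ : ℂ) * Complex.I) • x)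
    - Complex.exp ((θ : ℂ) * Complex.I) • (Mmat h σ2 x a).mulVec x
    + (((2 * σ2 + 1) / (m : ℝ) : ℝ) : ℂ) •
        (Amat h a)ᴴ.mulVec fun k =>
          ((zeta σ2 ((yvec h x a k : ℝ) : ℂ) : ℝ) : ℂ) *
            (((yvec h x a k : ℝ) : ℂ) * phase ((Amat h a).mulVec z k))

/-- Projection onto the orthogonal complement of a unit vector `x`. -/
def projPerp {n : ℕ} (x v : Fin n → ℂ) : Fin n → ℂ := v - dotc x v • x

/-- Projection onto the span of a unit vector `x`. -/
def projPar {n : ℕ} (x v : Fin n → ℂ) : Fin n → ℂ := dotc x v • x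

/-- The matrix `P_{x⊥} = I − x x^*`. -/
def Pperp {n : ℕ} (x : Fin n → ℂ) : Matrix (Fin n) (Fin n) ℂ :=
  1 - Matrix.vecMulVec x (star x)

/-- `T = (1/m) R_{[1:n]} C_g^* diag(b) C_g R_{[1:n]}ᵀ`. -/
def Tmat {n m : ℕ} (h : n ≤ m) (b : Fin m → ℝ) (g : Fin m → ℂ) :
    Matrix (Fin n) (Fin n) ℂ :=
  ((1 / (m : ℝ) : ℝ) : ℂ) •
    (((Matrix.circulant g)ᴴ * Matrix.diagonal (fun k => ((b k : ℝ) : ℂ)) *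
        Matrix.circulant g).submatrix (Fin.castLE h) (Fin.castLE h))

/-- `L(g) = ‖T − (1/m)(∑ b_k) I‖`. -/
def Lfun {n m : ℕ} (h : n ≤ m) (b : Fin m → ℝ) (g : Fin m → ℂ) : ℝ :=
  opNorm (Tmat h b g -
    (((1 / (m : ℝ)) * ∑ k, b k : ℝ) : ℂ) • (1 : Matrix (Fin n) (Fin n) ℂ))

/-- `G = R_{[1:n]} C_g^*`. -/
def Gmat {n m : ℕ} (h : n ≤ m) (g : Fin m → ℂ) : Matrix (Fin n) (Fin m) ℂ :=
  ((Matrix.circulant g)ᴴ).submatrix (Fin.castLE h) id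

/-- `ξ_{σ²}(t) = (1/(2πσ²)) exp(−|t|²/(2σ²))`. -/
def xiF (σ2 : ℝ) (t : ℂ) : ℝ :=
  (1 / (2 * Real.pi * σ2)) * Real.exp (-‖t‖ ^ 2 / (2 * σ2))

/-- `ζ_{σ²}(t) = 1 − 2πσ² ξ_{σ²}(t)`. -/
def zetaF (σ2 : ℝ) (t : ℂ) : ℝ := 1 - 2 * Real.pi * σ2 * xiF σ2 t

/-- `η_{σ²}(t) = 1 − 2πσ² ξ_{σ²−1/2}(t)`. -/
def etaF (σ2 : ℝ) (t : ℂ) : ℝ := 1 - 2 * Real.pi * σ2 * xiF (σ2 - 1 / 2) t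

/-- `ν_{σ²}(t) = 1 − (4πσ⁴/(2σ²−1)) ξ_{σ²−1/2}(t)`. -/
def nuF (σ2 : ℝ) (t : ℂ) : ℝ :=
  1 - (4 * Real.pi * σ2 ^ 2 / (2 * σ2 - 1)) * xiF (σ2 - 1 / 2) t

/-- `g(t) = E_{v₁,v₂ ∼ N(0,1/2)} [((|t|+v₁)² − v₂²)/((|t|+v₁)² + v₂²)]`. -/
def gfun (t : ℂ) : ℝ :=
  ∫ p : ℝ × ℝ, ((‖t‖ + p.1) ^ 2 - p.2 ^ 2) / ((‖t‖ + p.1) ^ 2 + p.2 ^ 2)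
    ∂((gaussianReal 0 (1 / 2 : ℝ≥0)).prod (gaussianReal 0 (1 / 2 : ℝ≥0)))

instance cgaussian.isProbabilityMeasure (σ2 : ℝ) : IsProbabilityMeasure (cgaussian σ2) :=
  Measure.isProbabilityMeasure_map (by fun_prop)

instance cgaussianVec.isProbabilityMeasure (m : ℕ) (σ2 : ℝ) :
    IsProbabilityMeasure (cgaussianVec m σ2) := by
  unfold cgaussianVec; infer_instance

lemma cgaussian_eq_map_equiv (σ2 : ℝ) :
    cgaussian σ2 = Measure.map Complex.measurableEquivRealProd.symm
      ((gaussianReal 0 (σ2 / 2).toNNReal).prod (gaussianReal 0 (σ2 / 2).toNNReal)) := by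
  unfold cgaussian
  congr 1
  ext p
  exact Complex.mk_eq_add_mul_I p.1 p.2 |>.symm

/-- The standard complex Gaussian has density `exp (-|z|²) / π`. -/
lemma integral_cgaussian_one {E : Type*} [NormedAddCommGroup E] [NormedSpace ℝ E] (f : ℂ → E) :
    ∫ z, f z ∂(cgaussian 1) = ∫ z, (Real.pi⁻¹ * Real.exp (-‖z‖ ^ 2)) • f z := by
  have hv : (1 / 2 : ℝ).toNNReal ≠ 0 := by simp
  rw [cgaussian_eq_map_equiv, integral_map_equiv, gaussianReal_of_var_ne_zero 0 hv,
    prod_withDensity (measurable_gaussianPDF _ _) (measurable_gaussianPDF _ _),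
    integral_withDensity_eq_integral_toReal_smul (by fun_prop)
      (Filter.Eventually.of_forall fun p => ENNReal.mul_lt_top gaussianPDF_lt_top
        gaussianPDF_lt_top),
    ← Measure.volume_eq_prod, ← Complex.volume_preserving_equiv_real_prod.integral_comp']
  refine integral_congr_ae (Filter.Eventually.of_forall fun z => ?_)
  simp only [MeasurableEquiv.symm_apply_apply]
  congr 1
  rw [ENNReal.toReal_mul, toReal_gaussianPDF, toReal_gaussianPDF, gaussianPDFReal, gaussianPDFReal]
  rw [mul_mul_mul_comm, ← Real.exp_add, ← mul_inv, Real.mul_self_sqrt (by positivity)]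
  have h2 : ((1 / 2 : ℝ).toNNReal : ℝ) = 1 / 2 := Real.coe_toNNReal _ (by norm_num)
  rw [h2, Complex.sq_norm, Complex.normSq_apply]
  simp only [Complex.measurableEquivRealProd_apply]
  congr 2 <;> ring

lemma integral_norm_sq_pow_mul_exp (k : ℕ) {c : ℝ} (hc : 0 ≤ c) :
    ∫ z, ‖z‖ ^ (2 * k) * Real.exp (-c * ‖z‖ ^ 2) ∂(cgaussian 1) =
      k.factorial / (1 + c) ^ (k + 1) := by
  rw [integral_cgaussian_one]
  have h := Complex.integral_rpow_mul_exp_neg_mul_rpow (p := 2) (q := (2 * k : ℕ)) (b := 1 + c)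
    (by norm_num) (by push_cast; linarith [k.cast_nonneg (α := ℝ)]) (by linarith)
  have h1 : -(((2 * k : ℕ) : ℝ) + 2) / 2 = -((k + 1 : ℕ) : ℝ) := by push_cast; ring
  have h2 : (((2 * k : ℕ) : ℝ) + 2) / 2 = k + 1 := by push_cast; ring
  rw [h1, h2, Real.Gamma_nat_eq_factorial, Real.rpow_neg (by linarith), Real.rpow_natCast] at h
  have hpi := Real.pi_ne_zero
  calc _ = ∫ z : ℂ, Real.pi⁻¹ *
        (‖z‖ ^ ((2 * k : ℕ) : ℝ) * Real.exp (-(1 + c) * ‖z‖ ^ (2 : ℝ))) := by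
        congr with z
        rw [Real.rpow_natCast, Real.rpow_two,
          show -(1 + c) * ‖z‖ ^ 2 = -‖z‖ ^ 2 + -c * ‖z‖ ^ 2 by ring,
          Real.exp_add, smul_eq_mul]
        ring
    _ = _ := by
        rw [integral_const_mul, h]
        field_simp

lemma integrable_norm_sq_pow_mul_exp (k : ℕ) {c : ℝ} (hc : 0 ≤ c) :
    Integrable (fun z : ℂ => ‖z‖ ^ (2 * k) * Real.exp (-c * ‖z‖ ^ 2)) (cgaussian 1) := by
  apply Integrable.of_integral_ne_zero
  rw [integral_norm_sq_pow_mul_exp k hc]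
  positivity

lemma zeta_eq (σ2 : ℝ) (t : ℂ) :
    zeta σ2 t = 1 - Real.exp (-(1 / (2 * σ2)) * ‖t‖ ^ 2) := by
  rw [zeta]; congr 2; ring

@[fun_prop]
lemma continuous_zeta (σ2 : ℝ) : Continuous (zeta σ2) := by
  simp_rw [funext (zeta_eq σ2)]; fun_prop

lemma zeta_norm (σ2 : ℝ) (t : ℂ) : zeta σ2 (‖t‖ : ℂ) = zeta σ2 t := by
  simp [zeta]

lemma norm_sq_pow_mul_zeta_eq (σ2 : ℝ) (k : ℕ) :
    (fun z : ℂ => ‖z‖ ^ (2 * k) * zeta σ2 z) = fun z =>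
      ‖z‖ ^ (2 * k) * Real.exp (-0 * ‖z‖ ^ 2) -
        ‖z‖ ^ (2 * k) * Real.exp (-(1 / (2 * σ2)) * ‖z‖ ^ 2) := by
  ext z; rw [zeta_eq]; simp; ring

lemma integral_norm_sq_pow_mul_zeta {σ2 : ℝ} (hσ : 0 < σ2) (k : ℕ) :
    ∫ z, ‖z‖ ^ (2 * k) * zeta σ2 z ∂(cgaussian 1) =
      k.factorial * (1 - (2 * σ2 / (2 * σ2 + 1)) ^ (k + 1)) := by
  rw [norm_sq_pow_mul_zeta_eq, integral_sub (integrable_norm_sq_pow_mul_exp k le_rfl)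
    (integrable_norm_sq_pow_mul_exp k (by positivity)),
    integral_norm_sq_pow_mul_exp k le_rfl, integral_norm_sq_pow_mul_exp k (by positivity),
    show 1 + 1 / (2 * σ2) = (2 * σ2 / (2 * σ2 + 1))⁻¹ by field_simp]
  rw [inv_pow, div_inv_eq_mul]
  simp [mul_sub]

lemma integral_id_cgaussian_one : ∫ z, z ∂(cgaussian 1) = 0 := by
  rw [integral_cgaussian_one]
  have h := integral_neg_eq_self (fun z : ℂ => (Real.pi⁻¹ * Real.exp (-‖z‖ ^ 2)) • z) volume
  simp only [norm_neg, smul_neg, integral_neg] at h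
  exact self_eq_neg.mp h.symm

lemma memLp_two_id_cgaussian_one : MemLp (fun z : ℂ => z) 2 (cgaussian 1) := by
  rw [memLp_two_iff_integrable_sq_norm (by fun_prop)]
  simpa using integrable_norm_sq_pow_mul_exp 1 le_rfl

lemma integrable_id_cgaussian_one : Integrable (fun z : ℂ => z) (cgaussian 1) :=
  memLp_two_id_cgaussian_one.integrable (by norm_num)

lemma charFunDual_cgaussian_one (L : StrongDual ℝ ℂ) :
    charFunDual (cgaussian 1) L = Complex.exp (-(((L 1) ^ 2 + (L Complex.I) ^ 2 : ℝ) : ℂ) / 4) := by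
  have h2 : (((1 / 2 : ℝ).toNNReal : ℝ) : ℂ) = 1 / 2 := by
    rw [Real.coe_toNNReal _ (by norm_num)]; norm_num
  have hL (p : ℝ × ℝ) : L (p.1 + p.2 * Complex.I) = L 1 * p.1 + L Complex.I * p.2 := by
    rw [show (p.1 + p.2 * Complex.I : ℂ) = p.1 • (1 : ℂ) + p.2 • Complex.I by simp, map_add,
      map_smul, map_smul, smul_eq_mul, smul_eq_mul]
    ring
  rw [charFunDual_apply, cgaussian, integral_map (by fun_prop) (by fun_prop)]
  simp_rw [hL, Complex.ofReal_add, add_mul, Complex.exp_add, Complex.ofReal_mul]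
  rw [integral_prod_mul (fun x : ℝ => Complex.exp (L 1 * x * Complex.I))
    (fun x : ℝ => Complex.exp (L Complex.I * x * Complex.I)), ← charFun_apply_real,
    ← charFun_apply_real, charFun_gaussianReal, charFun_gaussianReal, ← Complex.exp_add, h2]
  congr 1
  push_cast
  ring

lemma ofReal_sum_sq_eq_sum_conj {ι : Type*} [Fintype ι] (f h : ι → ℝ) :
    ((∑ j, (f j ^ 2 + h j ^ 2) : ℝ) : ℂ) =
      ∑ j, starRingEnd ℂ ((f j : ℂ) - h j * Complex.I) * ((f j : ℂ) - h j * Complex.I) := by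
  push_cast
  refine Finset.sum_congr rfl fun j _ => ?_
  simp only [map_sub, map_mul, Complex.conj_ofReal, Complex.conj_I]
  linear_combination ((h j : ℂ) ^ 2) * Complex.I_sq

lemma charFunDual_cgaussianVec {m : ℕ} (L : StrongDual ℝ (Fin m → ℂ)) :
    charFunDual (cgaussianVec m 1) L =
      Complex.exp (-(((∑ j, ((L (Pi.single j 1)) ^ 2 + (L (Pi.single j Complex.I)) ^ 2) : ℝ)) : ℂ)
        / 4) := by
  rw [cgaussianVec, charFunDual_pi]
  simp_rw [charFunDual_cgaussian_one]
  rw [← Complex.exp_sum]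
  congr 1
  rw [neg_div, Complex.ofReal_sum, Finset.sum_div, ← Finset.sum_neg_distrib]
  refine Finset.sum_congr rfl fun j _ => ?_
  rw [neg_div]
  rfl

/-- The complex coordinates of a real functional on `ℂ^m`. -/
lemma strongDual_apply_eq_re_dotProduct {m : ℕ} (L : StrongDual ℝ (Fin m → ℂ)) (z : Fin m → ℂ) :
    L z = ((fun j => (L (Pi.single j 1) : ℂ) - L (Pi.single j Complex.I) * Complex.I) ⬝ᵥ z).re := by
  have hz : z = ∑ j, ((z j).re • (Pi.single j 1 : Fin m → ℂ) +
      (z j).im • (Pi.single j Complex.I : Fin m → ℂ)) := by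
    ext i
    simp [Finset.sum_apply, Pi.single_apply, Finset.sum_add_distrib]
  conv_lhs => rw [hz]
  simp [dotProduct, Complex.re_sum, mul_comm]

lemma strongDual_sub_mul_I_eq {m : ℕ} (L : StrongDual ℝ (Fin m → ℂ)) (c : Fin m → ℂ)
    (hL : ∀ z, L z = (c ⬝ᵥ z).re) (j : Fin m) :
    (L (Pi.single j 1) : ℂ) - L (Pi.single j Complex.I) * Complex.I = c j := by
  apply Complex.ext <;> simp [hL]

/-- `CN(0, I_m)` is invariant under unitary transformations. -/
lemma map_mulVec_cgaussianVec {m : ℕ} (B : Matrix (Fin m) (Fin m) ℂ) (hB : B * Bᴴ = 1) :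
    Measure.map (fun g => B *ᵥ g) (cgaussianVec m 1) = cgaussianVec m 1 := by
  have hmeas : Measurable fun g : Fin m → ℂ => B *ᵥ g := by fun_prop
  have := Measure.isProbabilityMeasure_map (μ := cgaussianVec m 1) hmeas.aemeasurable
  refine Measure.ext_of_charFunDual (funext fun L => ?_)
  let T : (Fin m → ℂ) →L[ℝ] (Fin m → ℂ) :=
    (LinearMap.toContinuousLinearMap B.mulVecLin).restrictScalars ℝ
  have hT : charFunDual (Measure.map (fun g => B *ᵥ g) (cgaussianVec m 1)) L =
      charFunDual (cgaussianVec m 1) (L.comp T) := by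
    rw [charFunDual_apply, charFunDual_apply, integral_map hmeas.aemeasurable (by fun_prop)]
    rfl
  set c : Fin m → ℂ :=
    fun j => (L (Pi.single j 1) : ℂ) - L (Pi.single j Complex.I) * Complex.I with hc
  have hLT (z : Fin m → ℂ) : (L.comp T) z = ((c ᵥ* B) ⬝ᵥ z).re := by
    rw [← dotProduct_mulVec, ← strongDual_apply_eq_re_dotProduct]
    rfl
  rw [hT, charFunDual_cgaussianVec, charFunDual_cgaussianVec, ofReal_sum_sq_eq_sum_conj,
    ofReal_sum_sq_eq_sum_conj]
  simp_rw [strongDual_sub_mul_I_eq _ _ hLT]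
  congr 3
  change star (c ᵥ* B) ⬝ᵥ (c ᵥ* B) = star c ⬝ᵥ c
  rw [star_vecMul, dotProduct_comm, ← dotProduct_mulVec, mulVec_mulVec, hB, one_mulVec,
    dotProduct_comm]

/-- A unit vector is a column of some unitary matrix. -/
lemma exists_unitary_col_eq {m : ℕ} (i₀ : Fin m) (w : Fin m → ℂ) (hw : ∑ i, ‖w i‖ ^ 2 = 1) :
    ∃ B : Matrix (Fin m) (Fin m) ℂ, Bᴴ * B = 1 ∧ ∀ p, B p i₀ = w p := by
  have hnorm : ‖WithLp.toLp 2 w‖ = 1 := by simp [EuclideanSpace.norm_eq, hw]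
  obtain ⟨b, hb⟩ := Orthonormal.exists_orthonormalBasis_extension_of_card_eq
    (𝕜 := ℂ) (E := EuclideanSpace ℂ (Fin m)) (ι := Fin m) (by simp)
    (v := fun _ => WithLp.toLp 2 w) (s := {i₀})
    ⟨fun _ => hnorm, fun i j hij => (hij (Subsingleton.elim i j)).elim⟩
  refine ⟨Matrix.of fun p j => b j p, ?_, fun p => by simp [hb i₀ rfl]⟩
  ext i j
  rw [Matrix.one_apply, ← orthonormal_iff_ite.mp b.orthonormal i j]
  simp [Matrix.mul_apply, PiLp.inner_apply, mul_comm]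

lemma norm_zeta_le_one {σ2 : ℝ} (hσ : 0 < σ2) (t : ℂ) : ‖(zeta σ2 t : ℂ)‖ ≤ 1 := by
  have h1 : Real.exp (-(1 / (2 * σ2)) * ‖t‖ ^ 2) ≤ 1 := by
    rw [Real.exp_le_one_iff, neg_mul, neg_nonpos]
    positivity
  have h0 := Real.exp_pos (-(1 / (2 * σ2)) * ‖t‖ ^ 2)
  rw [Complex.norm_real, zeta_eq, Real.norm_eq_abs, abs_le]
  constructor <;> linarith

/-- The factor at coordinate `k` of `conj (g a) * g b * ζ (g i₀)`. -/
def momentFactor {m : ℕ} (σ2 : ℝ) (i₀ a b k : Fin m) (z : ℂ) : ℂ :=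
  ((if k = a then starRingEnd ℂ z else 1) * (if k = b then z else 1)) *
    (if k = i₀ then (zeta σ2 z : ℂ) else 1)

lemma prod_momentFactor {m : ℕ} (σ2 : ℝ) (i₀ a b : Fin m) (g : Fin m → ℂ) :
    ∏ k, momentFactor σ2 i₀ a b k (g k) =
      starRingEnd ℂ (g a) * g b * (zeta σ2 (g i₀) : ℂ) := by
  simp only [momentFactor, Finset.prod_mul_distrib, Finset.prod_ite_eq', Finset.mem_univ, if_true]

lemma integrable_momentFactor {m : ℕ} {σ2 : ℝ} (hσ : 0 < σ2) (i₀ a b k : Fin m) :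
    Integrable (momentFactor σ2 i₀ a b k) (cgaussian 1) := by
  have hconj : MemLp (fun z : ℂ => starRingEnd ℂ z) 2 (cgaussian 1) :=
    memLp_two_id_cgaussian_one.star
  refine Integrable.mul_bdd (c := 1) ?_ ?_ (Filter.Eventually.of_forall fun z => ?_)
  · split_ifs
    · exact hconj.integrable_mul memLp_two_id_cgaussian_one
    · simpa using hconj.integrable (by norm_num)
    · simpa using integrable_id_cgaussian_one
    · simp
  · split_ifs <;> fun_prop
  · split_ifs
    · exact norm_zeta_le_one hσ z
    · simp

lemma integral_conj_mul_mul_zeta_eval {m : ℕ} {σ2 : ℝ} (hσ : 0 < σ2) (i₀ a b : Fin m) :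
    ∫ g, starRingEnd ℂ (g a) * g b * (zeta σ2 (g i₀) : ℂ) ∂(cgaussianVec m 1) =
      if a = b then ((1 / (2 * σ2 + 1) : ℝ) : ℂ) +
        (if a = i₀ then ((2 * σ2 / (2 * σ2 + 1) ^ 2 : ℝ) : ℂ) else 0) else 0 := by
  have hconj : ∫ z : ℂ, starRingEnd ℂ z ∂(cgaussian 1) = 0 := by
    rw [integral_conj, integral_id_cgaussian_one, map_zero]
  have hsq : ∫ z : ℂ, starRingEnd ℂ z * z ∂(cgaussian 1) = 1 := by
    have h := integral_norm_sq_pow_mul_exp 1 le_rfl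
    simp only [neg_zero, zero_mul, Real.exp_zero, mul_one] at h
    simp_rw [Complex.conj_mul', ← Complex.ofReal_pow]
    rw [integral_complex_ofReal, h]
    simp
  have hz : ∫ z : ℂ, (zeta σ2 z : ℂ) ∂(cgaussian 1) = ((1 / (2 * σ2 + 1) : ℝ) : ℂ) := by
    have h := integral_norm_sq_pow_mul_zeta hσ 0
    simp only [mul_zero, pow_zero, one_mul] at h
    rw [integral_complex_ofReal, h]
    congr 1
    simp
    field_simp
    ring
  have hsqz : ∫ z : ℂ, starRingEnd ℂ z * z * (zeta σ2 z : ℂ) ∂(cgaussian 1) =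
      ((1 / (2 * σ2 + 1) : ℝ) : ℂ) + ((2 * σ2 / (2 * σ2 + 1) ^ 2 : ℝ) : ℂ) := by
    simp_rw [Complex.conj_mul', ← Complex.ofReal_pow, ← Complex.ofReal_mul]
    rw [integral_complex_ofReal, ← Complex.ofReal_add, ← mul_one 2,
      integral_norm_sq_pow_mul_zeta hσ 1]
    congr 1
    simp
    field_simp
    ring
  simp_rw [← prod_momentFactor]
  rw [cgaussianVec, integral_fintype_prod_eq_prod]
  by_cases hab : a = b
  · subst hab
    rw [if_pos rfl]
    by_cases hai : a = i₀
    · subst hai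
      rw [Finset.prod_eq_single a (fun k _ hk => by simp [momentFactor, hk]) (by simp)]
      simpa [momentFactor] using hsqz
    · rw [Finset.prod_eq_mul a i₀ hai (fun k _ hk => by simp [momentFactor, hk.1, hk.2])
        (by simp) (by simp)]
      simp [momentFactor, hai, Ne.symm hai, hsq, hz]
  · rw [if_neg hab]
    by_cases hai : a = i₀
    · subst hai
      refine Finset.prod_eq_zero (Finset.mem_univ b) ?_
      simpa [momentFactor, Ne.symm hab] using integral_id_cgaussian_one
    · refine Finset.prod_eq_zero (Finset.mem_univ a) ?_
      simpa [momentFactor, hab, hai] using hconj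

lemma integrable_conj_mul_mul_zeta_eval {m : ℕ} {σ2 : ℝ} (hσ : 0 < σ2) (i₀ a b : Fin m) :
    Integrable (fun g => starRingEnd ℂ (g a) * g b * (zeta σ2 (g i₀) : ℂ)) (cgaussianVec m 1) := by
  simp_rw [← prod_momentFactor]
  exact Integrable.fintype_prod fun k => integrable_momentFactor hσ i₀ a b k

lemma integrable_and_integral_conj_mul_mul_zeta {m : ℕ} {σ2 : ℝ} (hσ : 0 < σ2) (v : Fin m → ℂ)
    (hv : ∑ i, ‖v i‖ ^ 2 = 1) (p q : Fin m) :
    Integrable (fun g => starRingEnd ℂ (g p) * g q * (zeta σ2 (v ⬝ᵥ g) : ℂ))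
      (cgaussianVec m 1) ∧
    ∫ g, starRingEnd ℂ (g p) * g q * (zeta σ2 (v ⬝ᵥ g) : ℂ) ∂(cgaussianVec m 1) =
      ((1 / (2 * σ2 + 1) : ℝ) : ℂ) * (1 : Matrix (Fin m) (Fin m) ℂ) p q +
        ((2 * σ2 / (2 * σ2 + 1) ^ 2 : ℝ) : ℂ) * (v p * starRingEnd ℂ (v q)) := by
  obtain ⟨B, hB, hBv⟩ := exists_unitary_col_eq p (star v) (by simpa using hv)
  have hB' : B * Bᴴ = 1 := mul_eq_one_comm.mp hB
  have hvB : v ᵥ* B = Pi.single p 1 := by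
    ext j
    have h := congrFun (congrFun hB p) j
    simpa [Matrix.mul_apply, hBv, vecMul, dotProduct, Matrix.one_apply, Pi.single_apply, eq_comm]
      using h
  have hexp (g : Fin m → ℂ) : starRingEnd ℂ ((B *ᵥ g) p) * (B *ᵥ g) q *
      (zeta σ2 (v ⬝ᵥ (B *ᵥ g)) : ℂ) = ∑ a, ∑ b, (starRingEnd ℂ (B p a) * B q b) *
        (starRingEnd ℂ (g a) * g b * (zeta σ2 (g p) : ℂ)) := by
    rw [dotProduct_mulVec, hvB, single_dotProduct, one_mul]
    simp only [mulVec, dotProduct, map_sum, map_mul, Finset.sum_mul_sum]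
    simp_rw [Finset.sum_mul]
    exact Finset.sum_congr rfl fun a _ => Finset.sum_congr rfl fun b _ => by ring
  have hint (a b : Fin m) : Integrable (fun g => (starRingEnd ℂ (B p a) * B q b) *
      (starRingEnd ℂ (g a) * g b * (zeta σ2 (g p) : ℂ))) (cgaussianVec m 1) :=
    (integrable_conj_mul_mul_zeta_eval hσ p a b).const_mul _
  have hmeas : Measurable fun g : Fin m → ℂ => B *ᵥ g := by fun_prop
  rw [← map_mulVec_cgaussianVec B hB',
    integrable_map_measure (by fun_prop) hmeas.aemeasurable,
    integral_map hmeas.aemeasurable (by fun_prop)]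
  simp_rw [Function.comp_def, hexp]
  refine ⟨integrable_finsetSum _ fun a _ => integrable_finsetSum _ fun b _ => hint a b, ?_⟩
  rw [integral_finsetSum _ fun a _ => integrable_finsetSum _ fun b _ => hint a b]
  simp_rw [integral_finsetSum _ fun b _ => hint _ b, integral_const_mul,
    integral_conj_mul_mul_zeta_eval hσ]
  have hpq : (1 : Matrix (Fin m) (Fin m) ℂ) p q = ∑ a, starRingEnd ℂ (B p a) * B q a := by
    rw [← transpose_one, transpose_apply, ← hB']
    simp [Matrix.mul_apply, mul_comm]
  have hcol : v p * starRingEnd ℂ (v q) = starRingEnd ℂ (B p p) * B q p := by simp [hBv]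
  rw [hpq, hcol]
  simp only [mul_ite, mul_zero, mul_add, Finset.sum_ite_eq, Finset.sum_ite_eq', Finset.mem_univ,
    if_true, Finset.sum_add_distrib, Finset.mul_sum]
  simp only [mul_comm]

lemma sum_pad {n m : ℕ} (h : n ≤ m) (x : Fin n → ℂ) {R : Type*} [AddCommMonoid R]
    (f : Fin m → ℂ → R) (hf : ∀ r, f r 0 = 0) :
    ∑ r, f r (pad m x r) = ∑ i, f (Fin.castLE h i) (x i) := by
  refine (Fintype.sum_of_injective (Fin.castLE h) (Fin.castLE_injective h) _ _ ?_ ?_).symm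
  · intro r hr
    have : ¬ (r : ℕ) < n := fun hlt => hr ⟨⟨r, hlt⟩, rfl⟩
    simp [pad, this, hf]
  · intro i
    simp [pad]

lemma Amat_mulVec {n m : ℕ} (h : n ≤ m) (x : Fin n → ℂ) (g : Fin m → ℂ) (k : Fin m) :
    (Amat h g *ᵥ x) k = (fun r => pad m x (k - r)) ⬝ᵥ g := by
  have : NeZero m := ⟨k.pos.ne'⟩
  rw [dotProduct, ← Equiv.sum_comp (Equiv.subLeft k)]
  simp only [Equiv.subLeft_apply, sub_sub_cancel]
  rw [sum_pad h x (fun r t => t * g (k - r)) (by simp)]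
  simp [Amat, mulVec, dotProduct, mul_comm]

lemma Mmat_apply {n m : ℕ} (h : n ≤ m) (σ2 : ℝ) (x : Fin n → ℂ) (g : Fin m → ℂ) (i j : Fin n) :
    Mmat h σ2 x g i j = (((2 * σ2 + 1) / (m : ℝ) : ℝ) : ℂ) *
      ∑ k, starRingEnd ℂ (g (k - Fin.castLE h i)) * g (k - Fin.castLE h j) *
        (zeta σ2 ((fun r => pad m x (k - r)) ⬝ᵥ g) : ℂ) := by
  simp only [Mmat, Matrix.smul_apply, smul_eq_mul, Matrix.mul_apply (M := _ * _), mul_diagonal,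
    yvec, zeta_norm, Amat_mulVec]
  congr 1
  exact Finset.sum_congr rfl fun k _ => by simp [Amat]; ring

lemma integrable_and_integral_Mmat {n m : ℕ} (h : n ≤ m) {σ2 : ℝ} (hσ : 0 < σ2) (x : Fin n → ℂ)
    (hx : ∑ i, ‖x i‖ ^ 2 = 1) (i j : Fin n) :
    Integrable (fun g => Mmat h σ2 x g i j) (cgaussianVec m 1) ∧
    ∫ g, Mmat h σ2 x g i j ∂(cgaussianVec m 1) =
      ((1 : Matrix (Fin n) (Fin n) ℂ) +
        ((2 * σ2 / (1 + 2 * σ2) : ℝ) : ℂ) • vecMulVec x (star x)) i j := by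
  have hm : 0 < m := i.pos.trans_le h
  have : NeZero m := ⟨hm.ne'⟩
  have hpad (k : Fin m) : ∑ r, ‖pad m x (k - r)‖ ^ 2 = 1 := by
    rw [← Equiv.sum_comp (Equiv.subLeft k)]
    simp only [Equiv.subLeft_apply, sub_sub_cancel]
    rw [sum_pad h x (fun _ t => ‖t‖ ^ 2) (by simp), hx]
  have key (k : Fin m) := integrable_and_integral_conj_mul_mul_zeta hσ _ (hpad k)
    (k - Fin.castLE h i) (k - Fin.castLE h j)
  simp_rw [Mmat_apply]
  refine ⟨(integrable_finsetSum _ fun k _ => (key k).1).const_mul _, ?_⟩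
  rw [integral_const_mul, integral_finsetSum _ fun k _ => (key k).1]
  simp_rw [fun k => (key k).2, sub_sub_cancel]
  have hcast (l : Fin n) : pad m x (Fin.castLE h l) = x l := by simp [pad]
  have hm' : (m : ℂ) ≠ 0 := Nat.cast_ne_zero.mpr hm.ne'
  have h2 : (2 * σ2 + 1 : ℂ) ≠ 0 := by exact_mod_cast (by positivity : 2 * σ2 + 1 ≠ 0)
  have h2' : (1 + 2 * σ2 : ℂ) ≠ 0 := by rwa [add_comm]
  simp only [hcast, Finset.sum_const, Finset.card_univ, Fintype.card_fin, nsmul_eq_mul,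
    Matrix.one_apply, sub_right_inj, (Fin.castLE_injective h).eq_iff, Matrix.add_apply,
    Matrix.smul_apply, vecMulVec_apply, Pi.star_apply, smul_eq_mul, RCLike.star_def]
  push_cast
  field_simp
  ring

lemma Pperp_mulVec_self {n : ℕ} (x : Fin n → ℂ) (hx : ∑ i, ‖x i‖ ^ 2 = 1) :
    Pperp x *ᵥ x = 0 := by
  have hxx : star x ⬝ᵥ x = 1 := by
    simp only [dotProduct, Pi.star_apply, RCLike.star_def, Complex.conj_mul']
    exact_mod_cast hx
  rw [Pperp, sub_mulVec, one_mulVec, vecMulVec_mulVec, hxx]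
  simp

lemma Pperp_mul_Pperp {n : ℕ} (x : Fin n → ℂ) (hx : ∑ i, ‖x i‖ ^ 2 = 1) :
    Pperp x * Pperp x = Pperp x := by
  conv_lhs => rw [Pperp.eq_def x, mul_sub, mul_one, ← Pperp.eq_def, mul_vecMulVec,
    Pperp_mulVec_self x hx, zero_vecMulVec, sub_zero]

/-- Lemma C.4: expectations of `M(g)` and `H(g)`.
`E[M(g)] = P_{x⊥} + ((1+4σ²)/(1+2σ²)) x x^* = I + (2σ²/(1+2σ²)) x x^*` and
`E[H(g)] = P_{x⊥}`, entrywise. -/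
theorem M_H_expectation :
    ∀ σ2 : ℝ, 1 / 2 < σ2 →
    ∀ (n m : ℕ) (h : n ≤ m) (x : Fin n → ℂ), cnorm x = 1 →
      (∀ i j, (∫ g, Mmat h σ2 x g i j ∂(cgaussianVec m 1)) =
          (Pperp x +
            (((1 + 4 * σ2) / (1 + 2 * σ2) : ℝ) : ℂ) • Matrix.vecMulVec x (star x)) i j) ∧
      (∀ i j, (∫ g, Mmat h σ2 x g i j ∂(cgaussianVec m 1)) =
          ((1 : Matrix (Fin n) (Fin n) ℂ) +
            ((2 * σ2 / (1 + 2 * σ2) : ℝ) : ℂ) • Matrix.vecMulVec x (star x)) i j) ∧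
      (∀ i j, (∫ g, (Pperp x * Mmat h σ2 x g * Pperp x) i j ∂(cgaussianVec m 1)) =
          Pperp x i j) := by
  intro σ2 hσ2 n m h x hx
  have hσ : 0 < σ2 := by linarith
  have hx' : ∑ i, ‖x i‖ ^ 2 = 1 := by rwa [cnorm, Real.sqrt_eq_one] at hx
  have hM := integrable_and_integral_Mmat h hσ x hx'
  refine ⟨fun i j => ?_, fun i j => (hM i j).2, fun i j => ?_⟩
  · have h2 : (1 + 2 * σ2 : ℂ) ≠ 0 := by exact_mod_cast (by positivity : 1 + 2 * σ2 ≠ 0)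
    rw [(hM i j).2]
    simp only [Pperp, Matrix.add_apply, Matrix.sub_apply, Matrix.smul_apply, smul_eq_mul]
    push_cast
    field_simp
    ring
  · have hint (l k : Fin n) : Integrable
        (fun g => Pperp x i k * Mmat h σ2 x g k l * Pperp x l j) (cgaussianVec m 1) :=
      ((hM k l).1.const_mul _).mul_const _
    set N := (1 : Matrix (Fin n) (Fin n) ℂ) +
      ((2 * σ2 / (1 + 2 * σ2) : ℝ) : ℂ) • vecMulVec x (star x) with hN
    have hPN : Pperp x * N * Pperp x = Pperp x := by
      rw [hN, mul_add, mul_one, mul_smul_comm, mul_vecMulVec, Pperp_mulVec_self x hx',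
        zero_vecMulVec, smul_zero, add_zero, Pperp_mul_Pperp x hx']
    conv_rhs => rw [← hPN]
    simp only [Matrix.mul_apply, Finset.sum_mul]
    rw [integral_finsetSum _ fun l _ => integrable_finsetSum _ fun k _ => hint l k]
    simp_rw [integral_finsetSum _ fun k _ => hint _ k, integral_mul_const, integral_const_mul,
      fun k l => (hM k l).2]

end ConvPR

end
end

section
/- For every t ∈ ℂ, E_{s∼CN(0,1)}[ψ(t+s)] = g(t)·ψ(t), where g(t) := E_{v₁,v₂}[((|t|+v₁)² − v₂²)/((|t|+v₁)² + v₂²)] with v₁, v₂ independent real Gaussian random variables of law N(0, 1/2). In particular g(t) is a real number, so the Gaussian-smoothed phase E_{s∼CN(0,1)}[ψ(t+s)] is a real multiple of ψ(t). -/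
open MeasureTheory ProbabilityTheory Matrix Complex
open scoped NNReal ENNReal

noncomputable section

namespace ConvPR

lemma measurable_coe_add_coe_mul_I :
    Measurable fun p : ℝ × ℝ => (p.1 : ℂ) + (p.2 : ℂ) * Complex.I := by
  fun_prop

instance isProbabilityMeasure_cgaussian (σ2 : ℝ) : IsProbabilityMeasure (cgaussian σ2) :=
  Measure.isProbabilityMeasure_map measurable_coe_add_coe_mul_I.aemeasurable

lemma charFun_cgaussian (σ2 : ℝ) (z : ℂ) :
    charFun (cgaussian σ2) z =
      Complex.exp (-(((σ2 / 2).toNNReal : ℝ) * ‖z‖ ^ 2 / 2 : ℝ)) := by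
  have hchar (a : ℝ) := charFun_gaussianReal (μ := 0) (v := (σ2 / 2).toNNReal) a
  simp only [charFun_apply_real] at hchar
  rw [charFun_apply, cgaussian, integral_map measurable_coe_add_coe_mul_I.aemeasurable
    (by fun_prop)]
  calc _ = ∫ p : ℝ × ℝ, Complex.exp (z.re * p.1 * Complex.I) *
          Complex.exp (z.im * p.2 * Complex.I)
        ∂((gaussianReal 0 (σ2 / 2).toNNReal).prod (gaussianReal 0 (σ2 / 2).toNNReal)) := by
        refine integral_congr_ae (Filter.Eventually.of_forall fun p => ?_)
        simp only [← Complex.exp_add, Complex.inner]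
        congr 1
        simp
        ring
    _ = _ := by
        rw [integral_prod_mul (fun x : ℝ => Complex.exp (z.re * x * Complex.I))
          (fun y : ℝ => Complex.exp (z.im * y * Complex.I)), hchar, hchar, ← Complex.exp_add,
          Complex.sq_norm, Complex.normSq_apply]
        congr 1
        push_cast
        ring

/-- The complex Gaussian is invariant under the real-linear isometries of `ℂ`. -/
lemma measurePreserving_cgaussian (σ2 : ℝ) (e : ℂ ≃ₗᵢ[ℝ] ℂ) :
    MeasurePreserving e (cgaussian σ2) (cgaussian σ2) := by
  have he : Measurable e := e.continuous.measurable
  refine ⟨he, ?_⟩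
  have := Measure.isProbabilityMeasure_map (μ := cgaussian σ2) he.aemeasurable
  refine Measure.ext_of_charFun (funext fun z => ?_)
  have h : charFun ((cgaussian σ2).map e) z = charFun (cgaussian σ2) (e.symm z) := by
    rw [charFun_apply, charFun_apply, integral_map he.aemeasurable (by fun_prop)]
    refine integral_congr_ae (Filter.Eventually.of_forall fun x => ?_)
    simp only
    rw [← e.inner_map_map x, e.apply_symm_apply]
  rw [h, charFun_cgaussian, charFun_cgaussian, e.symm.norm_map]

lemma integral_cgaussian_comp (σ2 : ℝ) (e : ℂ ≃ₗᵢ[ℝ] ℂ) (f : ℂ → ℂ) :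
    ∫ s, f (e s) ∂(cgaussian σ2) = ∫ s, f s ∂(cgaussian σ2) :=
  (measurePreserving_cgaussian σ2 e).integral_comp
    e.toHomeomorph.measurableEmbedding f

lemma measurable_psi : Measurable psi := by
  have : Measurable phase :=
    Measurable.ite (measurableSet_singleton 0) measurable_const (by fun_prop)
  unfold psi
  exact (Complex.continuous_conj.measurable.comp this).pow_const 2

lemma norm_phase (u : ℂ) : ‖phase u‖ = 1 := by
  unfold phase
  split_ifs with h
  · simp
  · simp [h]

lemma norm_psi (u : ℂ) : ‖psi u‖ = 1 := by
  simp [psi, norm_phase]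

lemma norm_mul_phase (u : ℂ) : (‖u‖ : ℂ) * phase u = u := by
  unfold phase
  split_ifs with h
  · simp [h]
  · have : (‖u‖ : ℂ) ≠ 0 := by simpa using h
    field_simp

lemma psi_phase_mul (t u : ℂ) (hu : u ≠ 0) : psi (phase t * u) = psi t * psi u := by
  have ht : phase t ≠ 0 := norm_ne_zero_iff.mp (by simp [norm_phase])
  simp only [psi, ← mul_pow, ← map_mul]
  congr 2
  rw [phase, if_neg (mul_ne_zero ht hu), phase.eq_def u, if_neg hu, norm_mul, norm_phase, one_mul,
    mul_div_assoc]

lemma psi_conj (u : ℂ) : psi (starRingEnd ℂ u) = starRingEnd ℂ (psi u) := by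
  unfold psi phase
  split_ifs <;> simp_all

lemma re_psi (u : ℂ) (hu : u ≠ 0) :
    (psi u).re = (u.re ^ 2 - u.im ^ 2) / (u.re ^ 2 + u.im ^ 2) := by
  have h : psi u = ((‖u‖ ^ 2)⁻¹ : ℝ) * starRingEnd ℂ u ^ 2 := by
    rw [psi, phase, if_neg hu, map_div₀, Complex.conj_ofReal, div_pow]
    push_cast
    ring
  rw [h, Complex.re_ofReal_mul, Complex.sq_norm, Complex.normSq_apply, pow_two (starRingEnd ℂ u),
    Complex.mul_re, Complex.conj_re, Complex.conj_im, div_eq_inv_mul]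
  congr 1 <;> ring_nf

lemma ae_re_add_ne_zero (r : ℝ) {v : ℝ≥0} (hv : v ≠ 0) :
    ∀ᵐ p : ℝ × ℝ ∂((gaussianReal 0 v).prod (gaussianReal 0 v)), r + p.1 ≠ 0 := by
  have := nullSingletonClass_gaussianReal (μ := 0) hv
  have h : ∀ᵐ x : ℝ ∂(gaussianReal 0 v), r + x ≠ 0 := by
    filter_upwards [Measure.ae_ne (gaussianReal 0 v) (-r)] with x hx h
    exact hx (by linarith)
  exact Measure.quasiMeasurePreserving_fst.ae h

lemma ae_add_ne_zero_cgaussian (r : ℝ) {σ2 : ℝ} (hσ : 0 < σ2) :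
    ∀ᵐ s ∂(cgaussian σ2), (r : ℂ) + s ≠ 0 := by
  rw [cgaussian, ae_map_iff measurable_coe_add_coe_mul_I.aemeasurable
    (by measurability)]
  filter_upwards [ae_re_add_ne_zero r (v := (σ2 / 2).toNNReal) (by simpa using hσ)] with p hp h
  exact hp (by simpa using congrArg Complex.re h)

lemma integral_re_psi (t : ℂ) :
    ∫ s, (psi (‖t‖ + s)).re ∂(cgaussian 1) = gfun t := by
  have hv : ((1 : ℝ) / 2).toNNReal = 1 / 2 := by
    ext
    simp
  have hm : Measurable fun s : ℂ => (psi (‖t‖ + s)).re :=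
    Complex.measurable_re.comp (measurable_psi.comp (measurable_const_add _))
  rw [cgaussian, integral_map measurable_coe_add_coe_mul_I.aemeasurable
    hm.aestronglyMeasurable, hv, gfun]
  refine integral_congr_ae ?_
  filter_upwards [ae_re_add_ne_zero ‖t‖ (v := 1 / 2) (by simp)] with p hp
  rw [re_psi _ fun h => hp (by simpa using congrArg Complex.re h)]
  simp

lemma integral_psi_norm_add (t : ℂ) :
    ∫ s, psi (‖t‖ + s) ∂(cgaussian 1) = gfun t := by
  have hint : Integrable (fun s : ℂ => psi (‖t‖ + s)) (cgaussian 1) :=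
    Integrable.of_bound (measurable_psi.comp (measurable_const_add _)).aestronglyMeasurable 1
      (Filter.Eventually.of_forall fun s => (norm_psi _).le)
  have hconj : starRingEnd ℂ (∫ s, psi (‖t‖ + s) ∂(cgaussian 1)) =
      ∫ s, psi (‖t‖ + s) ∂(cgaussian 1) := by
    rw [← integral_conj, ← integral_cgaussian_comp 1 Complex.conjLIE fun s => psi (‖t‖ + s)]
    simp [← psi_conj]
  rw [← integral_re_psi, ← Complex.conj_eq_iff_re.mp hconj]
  congr 1
  exact (integral_re hint).symm

/-- Lemma 5.12: the Gaussian-smoothed phase is a real multiple of `ψ(t)`.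
`E_{s ∼ CN(0,1)}[ψ(t+s)] = g(t) ψ(t)` with
`g(t) = E_{v₁,v₂ ∼ N(0,1/2)}[((|t|+v₁)² − v₂²)/((|t|+v₁)² + v₂²)]` real. -/
theorem smoothed_phase_formula (t : ℂ) :
    (∫ s, psi (t + s) ∂(cgaussian 1)) = ((gfun t : ℝ) : ℂ) * psi t := by
  let c : Circle := ⟨phase t, by simp [Submonoid.unitSphere, norm_phase]⟩
  rw [← integral_psi_norm_add, ← integral_mul_const,
    ← integral_cgaussian_comp 1 (rotation c) fun s => psi (t + s)]
  refine integral_congr_ae ?_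
  filter_upwards [ae_add_ne_zero_cgaussian ‖t‖ one_pos] with s hs
  rw [mul_comm, ← psi_phase_mul t _ hs, mul_add, mul_comm (phase t) ‖t‖, norm_mul_phase]
  rfl

end ConvPR

end
end
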